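/- arXiv:1704.01825 — 2 statements merged into one kernel-verified Lean document; each statement's English description precedes it below -/
import Mathlib

section
/- (Dini-type test) Let f ∈ L¹(𝕋), x ∈ 𝕋, F = f∘θ_a^{-1}. If ∫_0^π |F(θ_a(x)+t) + F(θ_a(x)-t) - 2f(x)|/t dt < ∞, then S_n^a(f)(x) → f(x) as n → ∞. -/
open Real MeasureTheory Filter

/-- The Poisson kernel associated with `a = |a| e^{i t_a}`. -/
noncomputable def poisson (a : ℂ) (ta : ℝ) (t : ℝ) : ℝ :=
  (1 - ‖a‖ ^ 2) / (1 - 2 * ‖a‖ * Real.cos (t - ta) + ‖a‖ ^ 2)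

/-- The `k`-th nonlinear Fourier coefficient of `f`. -/
noncomputable def coeff (θ p : ℝ → ℝ) (f : ℝ → ℂ) (k : ℤ) : ℂ :=
  (1 / (2 * π)) * ∫ t in (-π)..π,
    f t * Complex.exp (-(Complex.I * (k : ℂ) * (θ t : ℂ))) * (p t : ℂ)

/-- The `n`-th partial sum of the nonlinear Fourier series of `f`. -/
noncomputable def partialSum (θ p : ℝ → ℝ) (f : ℝ → ℂ) (n : ℕ) (x : ℝ) : ℂ :=
  ∑ k ∈ Finset.Icc (-(n : ℤ)) (n : ℤ),
    coeff θ p f k * Complex.exp (Complex.I * (k : ℂ) * (θ x : ℂ))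

noncomputable def dirK (n : ℕ) (t : ℝ) : ℂ :=
  ∑ k ∈ Finset.Icc (-(n : ℤ)) (n : ℤ), Complex.exp (-(Complex.I * (k : ℂ) * (t : ℂ)))

lemma dirK_mul (n : ℕ) (t : ℝ) : dirK n t * (Complex.exp (Complex.I * t) - 1) =
    Complex.exp (Complex.I * ((n : ℂ) + 1) * t) - Complex.exp (-(Complex.I * n * t)) := by
  induction n with
  | zero => simp [dirK]
  | succ n ih =>
    have h : dirK (n+1) t = dirK n t + (Complex.exp (-(Complex.I * ((n : ℂ) + 1) * t))
        + Complex.exp (Complex.I * ((n : ℂ) + 1) * t)) := by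
      unfold dirK
      push_cast
      rw [Finset.sum_Icc_succ_eq_add_endpoints]
      push_cast
      have e : -(Complex.I * (-1 + -(n : ℂ)) * t) = Complex.I * ((n : ℂ) + 1) * t := by ring
      have e' : -(Complex.I * (-((n : ℂ) + 1)) * t) = Complex.I * ((n : ℂ) + 1) * t := by ring
      simp only [e, e']
      ring
    rw [h, add_mul, ih]
    have e1 : Complex.exp (Complex.I * (((n + 1 : ℕ) : ℂ) + 1) * t) =
      Complex.exp (Complex.I * ((n : ℂ) + 1) * t) * Complex.exp (Complex.I * t) := by
      rw [← Complex.exp_add]; congr 1; push_cast; ring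
    have e2 : Complex.exp (-(Complex.I * n * t)) =
      Complex.exp (-(Complex.I * ((n : ℂ) + 1) * t)) * Complex.exp (Complex.I * t) := by
      rw [← Complex.exp_add]; congr 1; ring
    rw [e1, e2]
    push_cast
    ring

lemma dirK_neg (n : ℕ) (t : ℝ) : dirK n (-t) = dirK n t := by
  unfold dirK
  refine Finset.sum_nbij' (fun k => -k) (fun k => -k) ?_ ?_ ?_ ?_ ?_
  · intro k hk; simp only [Finset.mem_Icc] at *; omega
  · intro k hk; simp only [Finset.mem_Icc] at *; omega
  · simp
  · simp
  · intro k _; congr 1; push_cast; ring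

lemma dirK_cont (n : ℕ) : Continuous (dirK n) := by
  unfold dirK
  fun_prop

lemma dirK_int (n : ℕ) : ∫ t in (-π)..π, dirK n t = 2 * π := by
  unfold dirK
  rw [intervalIntegral.integral_finsetSum
    (fun k _ => (Continuous.intervalIntegrable (by fun_prop) _ _))]
  rw [Finset.sum_eq_single 0]
  · simp; ring
  · intro k _ hk
    have hc : -(Complex.I * (k : ℂ)) ≠ 0 := by simp [hk]
    have := integral_exp_mul_complex (a := -π) (b := π) hc
    simp only [neg_mul] at this ⊢
    rw [this, div_eq_zero_iff]
    left
    rw [sub_eq_zero, Complex.exp_eq_exp_iff_exists_int]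
    refine ⟨-k, ?_⟩
    push_cast
    ring
  · simp

lemma RLseq (h : ℝ → ℂ) (w : ℕ → ℝ) (hw : Tendsto w atTop (cocompact ℝ)) :
    Tendsto (fun n => ∫ t in (-π)..π, h t * Complex.exp (Complex.I * (w n : ℂ) * t)) atTop
      (nhds 0) := by
  have hw' : Tendsto (fun n => w n * (-(2*π)⁻¹)) atTop (cocompact ℝ) := by
    have hne : (-(2*π)⁻¹ : ℝ) ≠ 0 := by simp [Real.pi_ne_zero]
    exact ((Homeomorph.mulRight₀ _ hne).isClosedEmbedding.tendsto_cocompact).comp hw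
  have := (Real.tendsto_integral_exp_smul_cocompact
    ((Set.Ioc (-π) π).indicator h)).comp hw'
  refine this.congr fun n => ?_
  rw [intervalIntegral.integral_of_le (by linarith [Real.pi_pos]),
    ← integral_indicator measurableSet_Ioc]
  simp only [Function.comp]
  congr 1
  ext t
  by_cases ht : t ∈ Set.Ioc (-π) π
  · rw [Set.indicator_of_mem ht, Set.indicator_of_mem ht, Circle.smul_def, Real.fourierChar_apply,
      smul_eq_mul, mul_comm]
    congr 2
    push_cast
    have : (π : ℂ) ≠ 0 := by exact_mod_cast Real.pi_ne_zero
    field_simp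
  · rw [Set.indicator_of_notMem ht, Set.indicator_of_notMem ht, smul_zero]

lemma exp_lower (t : ℝ) (ht : |t| ≤ π) : 2 / π * |t| ≤ ‖Complex.exp (Complex.I * t) - 1‖ := by
  rw [Complex.norm_exp_I_mul_ofReal_sub_one, norm_mul, Real.norm_eq_abs, Real.norm_eq_abs]
  have := Real.mul_abs_le_abs_sin (x := t/2) (by rw [abs_div]; simp; linarith)
  rw [abs_div] at this
  simp only [Nat.abs_ofNat] at this ⊢
  linarith

lemma dini_core (Φ : ℝ → ℂ) (hΦ : IntervalIntegrable Φ volume (-π) π) (c : ℂ)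
    (hd : IntervalIntegrable (fun t => ‖Φ t + Φ (-t) - 2 * c‖ / t) volume 0 π) :
    Tendsto (fun n => (1 / (2 * π) : ℂ) * ∫ t in (-π)..π, Φ t * dirK n t) atTop (nhds c) := by
  have hpi := Real.pi_pos
  set g : ℝ → ℂ := fun t => Φ t + Φ (-t) - 2 * c with hg
  have hΦ' : IntervalIntegrable (fun t => Φ (-t)) volume (-π) π := by
    have := (IntervalIntegrable.iff_comp_neg (f := Φ)).1 hΦ
    simpa using this.symm
  have hgi : IntervalIntegrable g volume (-π) π := (hΦ.add hΦ').sub (by simp)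
  have hgneg : ∀ t, g (-t) = g t := by intro t; simp [hg, add_comm]
  have hq : IntervalIntegrable (fun t => ‖g t‖ / |t|) volume (-π) π := by
    have h1 : IntervalIntegrable (fun t => ‖g t‖ / |t|) volume 0 π := by
      refine hd.congr ?_
      intro t ht
      rw [Set.uIoc_of_le hpi.le] at ht
      simp [hg, abs_of_pos ht.1]
    have h2 := (IntervalIntegrable.iff_comp_neg (f := fun t => ‖g t‖ / |t|)).1 h1
    simp only [hgneg, abs_neg, neg_zero] at h2
    exact h2.symm.trans h1
  set h : ℝ → ℂ := fun t => g t / (Complex.exp (Complex.I * t) - 1) with hh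
  have hhi : IntervalIntegrable h volume (-π) π := by
    refine (hq.const_mul (π / 2)).mono_fun ?_ ?_
    · have : Measurable (fun t : ℝ => (Complex.exp (Complex.I * t) - 1)⁻¹) := by fun_prop
      simp only [hh, div_eq_mul_inv]
      exact
        (hgi.def'.aestronglyMeasurable.mul this.aestronglyMeasurable)
    · refine (ae_restrict_iff' measurableSet_uIoc).2 (Eventually.of_forall fun t ht => ?_)
      rw [Set.uIoc_of_le (by linarith)] at ht
      have hta : |t| ≤ π := abs_le.2 ⟨ht.1.le, ht.2⟩
      have hl := exp_lower t hta
      simp only [hh, norm_div, norm_mul, Real.norm_eq_abs, abs_abs, abs_norm]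
      rw [abs_of_pos hpi]
      simp only [Nat.abs_ofNat]
      rcases eq_or_ne t 0 with rfl | h0
      · simp
      have hp : 0 < |t| := abs_pos.2 h0
      calc ‖g t‖ / ‖Complex.exp (Complex.I * t) - 1‖ ≤ ‖g t‖ / (2 / π * |t|) := by gcongr
        _ = _ := by field_simp
  have key : ∀ n, (1 / (2 * π) : ℂ) * ∫ t in (-π)..π, Φ t * dirK n t = c + (1 / (4 * π) : ℂ) *
      ((∫ t in (-π)..π, h t * Complex.exp (Complex.I * (((n : ℝ) + 1 : ℝ) : ℂ) * t)) -
       ∫ t in (-π)..π, h t * Complex.exp (Complex.I * ((-(n : ℝ) : ℝ) : ℂ) * t)) := by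
    intro n
    have hD := (dirK_cont n).continuousOn (s := Set.uIcc (-π) π)
    rw [← intervalIntegral.integral_sub
      (hhi.mul_continuousOn (Continuous.continuousOn (by fun_prop)))
      (hhi.mul_continuousOn (Continuous.continuousOn (by fun_prop)))]
    have e1 : (∫ t in (-π)..π, (h t * Complex.exp (Complex.I * (((n : ℝ) + 1 : ℝ) : ℂ) * t) -
        h t * Complex.exp (Complex.I * ((-(n : ℝ) : ℝ) : ℂ) * t))) =
        ∫ t in (-π)..π, g t * dirK n t := by
      refine intervalIntegral.integral_congr_ae ?_
      have : ∀ᵐ t : ℝ, t ≠ 0 := by simp [ae_iff]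
      filter_upwards [this] with t h0 ht
      rw [Set.uIoc_of_le (by linarith)] at ht
      have hta : |t| ≤ π := abs_le.2 ⟨ht.1.le, ht.2⟩
      have hl := exp_lower t hta
      have hp : 0 < |t| := abs_pos.2 h0
      have hne : Complex.exp (Complex.I * t) - 1 ≠ 0 := by
        rw [← norm_pos_iff]
        exact lt_of_lt_of_le (by positivity) hl
      rw [← mul_sub]
      have := dirK_mul n t
      simp only [hh]
      rw [div_mul_eq_mul_div, div_eq_iff hne, mul_assoc (g t) (dirK n t), this]
      push_cast
      have e : Complex.I * (-(n : ℂ)) * t = -(Complex.I * n * t) := by ring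
      rw [e]
    have e2 : (∫ t in (-π)..π, Φ (-t) * dirK n t) = ∫ t in (-π)..π, Φ t * dirK n t := by
      have := intervalIntegral.integral_comp_neg (a := -π) (b := π) (fun t => Φ t * dirK n t)
      simpa [dirK_neg] using this
    have e3 : (∫ t in (-π)..π, g t * dirK n t) =
        2 * (∫ t in (-π)..π, Φ t * dirK n t) - 2 * c * (2 * π) := by
      simp only [hg, sub_mul, add_mul]
      rw [intervalIntegral.integral_sub ((hΦ.mul_continuousOn hD).add (hΦ'.mul_continuousOn hD))
        (((dirK_cont n).const_mul _).intervalIntegrable _ _),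
        intervalIntegral.integral_add (hΦ.mul_continuousOn hD) (hΦ'.mul_continuousOn hD), e2,
        intervalIntegral.integral_const_mul, dirK_int]
      ring
    rw [e1, e3]
    have : (π : ℂ) ≠ 0 := by exact_mod_cast Real.pi_ne_zero
    field_simp
    ring
  simp_rw [key]
  have l1 := RLseq h (fun n => (n : ℝ) + 1) ((tendsto_atTop_add_const_right _ _
    tendsto_natCast_atTop_atTop).mono_right atTop_le_cocompact)
  have l2 := RLseq h (fun n => -(n : ℝ)) ((tendsto_neg_atTop_atBot.comp
    tendsto_natCast_atTop_atTop).mono_right atBot_le_cocompact)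
  simpa using ((l1.sub l2).const_mul (1 / (4 * π) : ℂ)).const_add c

lemma poisson_den (a : ℂ) (ha : ‖a‖ < 1) (s : ℝ) :
    0 < 1 - 2 * ‖a‖ * Real.cos s + ‖a‖ ^ 2 := by
  have h1 := Real.cos_le_one s
  have h2 := norm_nonneg a
  nlinarith [mul_nonneg h2 (sub_nonneg.2 h1), sq_nonneg (1 - ‖a‖), mul_pos (sub_pos.2 ha) (sub_pos.2 ha)]

lemma poisson_pos (a : ℂ) (ha : ‖a‖ < 1) (ta t : ℝ) : 0 < poisson a ta t := by
  refine div_pos ?_ (poisson_den a ha _)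
  nlinarith [norm_nonneg a]

lemma poisson_cont (a : ℂ) (ha : ‖a‖ < 1) (ta : ℝ) : Continuous (poisson a ta) := by
  unfold poisson
  exact Continuous.div (by fun_prop) (by fun_prop) (fun t => (poisson_den a ha _).ne')

theorem dini_test_nonlinear_fourier
    (a : ℂ) (ha : ‖a‖ < 1) (ta : ℝ) (hA : a = (‖a‖ : ℂ) * Complex.exp (Complex.I * (ta : ℂ)))
    (θ : ℝ → ℝ) (hθc : Continuous θ) (hθm : StrictMono θ)
    (hper : ∀ t : ℝ, θ (t + 2 * π) = θ t + 2 * π)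
    (hderiv : ∀ t : ℝ, HasDerivAt θ (poisson a ta t) t)
    (θinv : ℝ → ℝ) (hinv₁ : ∀ t, θinv (θ t) = t) (hinv₂ : ∀ t, θ (θinv t) = t)
    (f : ℝ → ℂ) (hfm : Measurable f) (hfper : Function.Periodic f (2 * π))
    (hfi : IntervalIntegrable f MeasureTheory.volume (-π) π)
    (F : ℝ → ℂ) (hF : F = f ∘ θinv)
    (x : ℝ)
    (hdini : IntervalIntegrable
      (fun t => ‖F (θ x + t) + F (θ x - t) - 2 * f x‖ / t)
      MeasureTheory.volume 0 π) :
    Tendsto (fun n : ℕ => partialSum θ (poisson a ta) f n x) atTop (nhds (f x)) := by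
  have hpi := Real.pi_pos
  have hle : (-π) ≤ π := by linarith
  have hFθ : ∀ t, F (θ t) = f t := by intro t; simp [hF, hinv₁]
  have hFper : Function.Periodic F (2 * π) := by
    intro u
    obtain ⟨t, rfl⟩ : ∃ t, θ t = u := ⟨_, hinv₂ u⟩
    rw [← hper, hFθ, hFθ, hfper]
  have hend : θ π = θ (-π) + 2 * π := by rw [← hper]; congr 1; ring
  have himg : θ '' Set.Ioc (-π) π = Set.Ioc (θ (-π)) (θ π) := by
    ext u
    constructor
    · rintro ⟨t, ht, rfl⟩
      exact ⟨hθm ht.1, hθm.monotone ht.2⟩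
    · intro hu
      refine ⟨θinv u, ⟨?_, ?_⟩, hinv₂ u⟩
      · rw [← hθm.lt_iff_lt, hinv₂]; exact hu.1
      · rw [← hθm.le_iff_le, hinv₂]; exact hu.2
  have hdw : ∀ t ∈ Set.Ioc (-π) π, HasDerivWithinAt θ (poisson a ta t) (Set.Ioc (-π) π) t :=
    fun t _ => (hderiv t).hasDerivWithinAt
  have hθle : θ (-π) ≤ θ π := hθm.monotone hle
  have hFi0 : IntervalIntegrable F volume (θ (-π)) (θ (-π) + 2 * π) := by
    rw [← hend, intervalIntegrable_iff_integrableOn_Ioc_of_le hθle, ← himg,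
      integrableOn_image_iff_integrableOn_abs_deriv_smul measurableSet_Ioc hdw
        hθm.injective.injOn]
    rw [← intervalIntegrable_iff_integrableOn_Ioc_of_le hle]
    have := hfi.continuousOn_smul (f := fun t => |poisson a ta t|)
      ((poisson_cont a ha ta).abs.continuousOn)
    simpa only [hFθ] using this
  have hFi : ∀ b c, IntervalIntegrable F volume b c :=
    fun b c => hFper.intervalIntegrable (by positivity) hFi0 b c
  have hcoeff : ∀ k : ℤ, coeff θ (poisson a ta) f k * Complex.exp (Complex.I * (k : ℂ) * (θ x : ℂ))
      = (1 / (2 * π) : ℂ) * ∫ t in (-π)..π,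
        F (θ x + t) * Complex.exp (-(Complex.I * (k : ℂ) * (t : ℂ))) := by
    intro k
    set G : ℝ → ℂ := fun u => F u * Complex.exp (-(Complex.I * (k : ℂ) * (u : ℂ))) with hG
    have hGper : Function.Periodic G (2 * π) := by
      intro u
      simp only [hG, hFper u]
      congr 1
      rw [Complex.exp_eq_exp_iff_exists_int]
      refine ⟨-k, ?_⟩
      push_cast
      ring
    have h1 : (∫ t in (-π)..π, f t * Complex.exp (-(Complex.I * (k : ℂ) * (θ t : ℂ))) *
        (poisson a ta t : ℂ)) = ∫ u in (θ (-π))..(θ π), G u := by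
      rw [intervalIntegral.integral_of_le hθle, ← himg,
        integral_image_eq_integral_abs_deriv_smul measurableSet_Ioc hdw hθm.injective.injOn,
        intervalIntegral.integral_of_le hle]
      congr 1
      ext t
      simp only [hG, hFθ, abs_of_pos (poisson_pos a ha ta t), Complex.real_smul]
      ring
    have h2 : (∫ u in (θ (-π))..(θ π), G u) = ∫ t in (-π)..π, G (θ x + t) := by
      rw [intervalIntegral.integral_comp_add_left, hend,
        hGper.intervalIntegral_add_eq _ (θ x + -π)]
      congr 1
      ring
    unfold coeff
    rw [h1, h2, mul_assoc, ← intervalIntegral.integral_mul_const]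
    congr 2
    ext t
    simp only [hG]
    rw [mul_assoc, ← Complex.exp_add]
    congr 2
    push_cast
    ring
  have hΦ : IntervalIntegrable (fun t => F (θ x + t)) volume (-π) π := by
    have := (hFi (θ x + -π) (θ x + π)).comp_add_left (θ x)
    simpa using this
  have hcore := dini_core (fun t => F (θ x + t)) hΦ (f x) (by simpa [← sub_eq_add_neg] using hdini)
  refine hcore.congr fun n => ?_
  unfold partialSum
  simp_rw [hcoeff]
  rw [← Finset.mul_sum, ← intervalIntegral.integral_finsetSum
    (fun k _ => hΦ.mul_continuousOn (Continuous.continuousOn (by fun_prop)))]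
  simp only [dirK, Finset.mul_sum]
end

section
/- (Bernstein inequality for nonlinear trigonometric polynomials) Let 1 ≤ p < ∞ and t_{n,a} ∈ τ_n^a = span{e^{ikθ_a(t)} : |k| ≤ n}. Then ‖t_{n,a}'‖_p ≤ C n ((1+|a|)/(1-|a|))^{2+2/p} ‖t_{n,a}‖_p with an absolute constant C. -/
open Real MeasureTheory

/-- The normalized `L^p` norm on one period. -/
noncomputable def pNorm (p : ℝ) (g : ℝ → ℂ) : ℝ :=
  ((1 / (2 * π)) * ∫ t in (-π)..π, ‖g t‖ ^ p) ^ (1 / p)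

/-- A nonlinear trigonometric polynomial of degree at most `n` with
coefficients `c`. -/
noncomputable def nltrigPoly (θ : ℝ → ℝ) (n : ℕ) (c : ℤ → ℂ) (x : ℝ) : ℂ :=
  ∑ k ∈ Finset.Icc (-(n : ℤ)) (n : ℤ),
    c k * Complex.exp (Complex.I * (k : ℂ) * (θ x : ℂ))


lemma aux_root_sum (N : ℕ) (hN : 0 < N) (m : ℤ) (hm : |m| < N) :
    ∑ j ∈ Finset.range N, Complex.exp (Complex.I * (m : ℂ) * ((2 * π * j / N : ℝ) : ℂ)) =
      if m = 0 then (N : ℂ) else 0 := by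
  split_ifs with h
  · subst h; simp
  · have hω := Complex.isPrimitiveRoot_exp N hN.ne'
    set ω := Complex.exp (2 * π * Complex.I / N) with hωd
    have h1 : ω ^ m ≠ 1 := by
      intro h2
      rw [hω.zpow_eq_one_iff_dvd] at h2
      exact h (Int.eq_zero_of_abs_lt_dvd h2 hm)
    have h3 : ∀ j : ℕ, Complex.exp (Complex.I * (m : ℂ) * ((2 * π * j / N : ℝ) : ℂ)) =
        (ω ^ m) ^ j := by
      intro j
      rw [hωd, ← Complex.exp_int_mul, ← Complex.exp_nat_mul]
      congr 1
      push_cast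
      ring
    simp_rw [h3]
    rw [geom_sum_eq h1]
    have : (ω ^ m) ^ N = 1 := by
      rw [← zpow_natCast, ← zpow_mul, mul_comm, zpow_mul, zpow_natCast, hω.pow_eq_one, one_zpow]
    rw [this]; simp

noncomputable def auxS (n : ℕ) (t : ℝ) : ℂ :=
  ∑ l ∈ Finset.Ico (0 : ℤ) n, Complex.exp (Complex.I * (l : ℂ) * (t : ℂ))

lemma aux_S_sq (n : ℕ) (t : ℝ) (k : ℤ) :
    ((‖auxS n t‖ ^ 2 : ℝ) : ℂ) * Complex.exp (Complex.I * (k : ℂ) * (t : ℂ)) =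
      ∑ l ∈ Finset.Ico (0 : ℤ) n, ∑ m ∈ Finset.Ico (0 : ℤ) n,
        Complex.exp (Complex.I * ((l - m + k : ℤ) : ℂ) * (t : ℂ)) := by
  have : ((‖auxS n t‖ ^ 2 : ℝ) : ℂ) = auxS n t * (starRingEnd ℂ) (auxS n t) := by
    rw [Complex.mul_conj, Complex.normSq_eq_norm_sq]
  rw [this, auxS, map_sum, Finset.sum_mul_sum, Finset.sum_mul]
  refine Finset.sum_congr rfl fun l _ => ?_
  rw [Finset.sum_mul]
  refine Finset.sum_congr rfl fun m _ => ?_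
  rw [← Complex.exp_conj, ← Complex.exp_add, ← Complex.exp_add]
  congr 1
  simp
  ring

lemma aux_count (n : ℕ) (k : ℤ) :
    ∑ l ∈ Finset.Ico (0 : ℤ) n, ∑ m ∈ Finset.Ico (0 : ℤ) n,
      (if l - m + k = 0 then (1 : ℤ) else 0) = max 0 (n - |k|) := by
  have h1 : ∀ l ∈ Finset.Ico (0 : ℤ) n, ∑ m ∈ Finset.Ico (0 : ℤ) n,
      (if l - m + k = 0 then (1 : ℤ) else 0) = if l + k ∈ Finset.Ico (0 : ℤ) n then 1 else 0 := by
    intro l _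
    rw [← Finset.sum_ite_eq (Finset.Ico (0 : ℤ) n) (l + k) (fun _ => (1 : ℤ))]
    refine Finset.sum_congr rfl fun m _ => ?_
    congr 1
    exact propext ⟨fun h => by omega, fun h => by omega⟩
  rw [Finset.sum_congr rfl h1, Finset.sum_boole]
  have h2 : (Finset.Ico (0 : ℤ) n).filter (fun l => l + k ∈ Finset.Ico (0 : ℤ) n) =
      Finset.Ico (max 0 (-k)) (min n (n - k)) := by
    ext l
    simp only [Finset.mem_filter, Finset.mem_Ico]
    omega
  rw [h2, Int.card_Ico]
  rw [Int.toNat_eq_max]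
  rcases abs_cases k with h | h <;> omega

lemma aux_fejer (n : ℕ) (hn : 0 < n) (k : ℤ) (hk : |k| ≤ 2 * n) :
    ∑ j ∈ Finset.range (3 * n), ((‖auxS n (2 * π * j / (3 * n : ℕ))‖ ^ 2 : ℝ) : ℂ) *
      Complex.exp (Complex.I * (k : ℂ) * ((2 * π * j / (3 * n : ℕ) : ℝ) : ℂ)) =
      (3 * n : ℂ) * ((max 0 (n - |k|) : ℤ) : ℂ) := by
  simp_rw [aux_S_sq]
  rw [Finset.sum_comm, ← aux_count]
  push_cast
  rw [Finset.mul_sum]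
  refine Finset.sum_congr rfl fun l hl => ?_
  rw [Finset.sum_comm, Finset.mul_sum]
  refine Finset.sum_congr rfl fun m hm => ?_
  rw [Finset.mem_Ico] at hl hm
  have hlt : |l - m + k| < (3 * n : ℕ) := by
    push_cast
    rw [abs_le] at hk
    rw [abs_lt]; omega
  have := aux_root_sum (3 * n) (by omega) (l - m + k) hlt
  push_cast at this
  rw [this]
  have e : ((l : ℂ) - m + k = 0) ↔ (l - m + k = 0) := by norm_cast
  simp

noncomputable def auxW (n : ℕ) (j : ℕ) : ℝ :=
  ‖auxS n (2 * π * j / (3 * n : ℕ))‖ ^ 2 / (3 * n * n)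

lemma aux_W_exp (n : ℕ) (hn : 0 < n) (k : ℤ) (hk : |k| ≤ 2 * n) :
    ∑ j ∈ Finset.range (3 * n), (auxW n j : ℂ) *
      Complex.exp (Complex.I * (k : ℂ) * ((2 * π * j / (3 * n : ℕ) : ℝ) : ℂ)) =
      ((max 0 (n - |k|) : ℤ) : ℂ) / n := by
  have h := aux_fejer n hn k hk
  have hn' : (n : ℂ) ≠ 0 := by exact_mod_cast hn.ne'
  have : ∀ j : ℕ, (auxW n j : ℂ) *
      Complex.exp (Complex.I * (k : ℂ) * ((2 * π * j / (3 * n : ℕ) : ℝ) : ℂ)) =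
      (((‖auxS n (2 * π * j / (3 * n : ℕ))‖ ^ 2 : ℝ) : ℂ) *
      Complex.exp (Complex.I * (k : ℂ) * ((2 * π * j / (3 * n : ℕ) : ℝ) : ℂ))) / (3 * n * n) := by
    intro j
    rw [auxW, Complex.ofReal_div]
    push_cast
    ring
  simp_rw [this]
  rw [← Finset.sum_div, h]
  field_simp

lemma aux_W_sum (n : ℕ) (hn : 0 < n) : ∑ j ∈ Finset.range (3 * n), auxW n j = 1 := by
  have h := aux_W_exp n hn 0 (by simp)
  have hn' : (n : ℂ) ≠ 0 := by exact_mod_cast hn.ne'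
  simp [hn'] at h
  exact_mod_cast h

lemma aux_W_nonneg (n j : ℕ) : 0 ≤ auxW n j := by unfold auxW; positivity

/-- derivative of the linear trigonometric polynomial -/
noncomputable def auxD (n : ℕ) (c : ℤ → ℂ) (x : ℝ) : ℂ :=
  nltrigPoly id n (fun k => c k * (Complex.I * k)) x

lemma aux_interp (n : ℕ) (hn : 0 < n) (c : ℤ → ℂ) (x : ℝ) :
    auxD n c x = ∑ j ∈ Finset.range (3 * n), (auxW n j : ℂ) *
      ((n / Complex.I) * (Complex.exp (Complex.I * ((n : ℤ) : ℂ) * ((2 * π * j / (3 * n : ℕ) : ℝ) : ℂ))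
        - Complex.exp (Complex.I * ((-(n : ℤ) : ℤ) : ℂ) * ((2 * π * j / (3 * n : ℕ) : ℝ) : ℂ)))) *
      nltrigPoly id n c (x + 2 * π * j / (3 * n : ℕ)) := by
  have hn' : (n : ℂ) ≠ 0 := by exact_mod_cast hn.ne'
  unfold auxD nltrigPoly
  simp_rw [Finset.mul_sum]
  rw [Finset.sum_comm]
  refine Finset.sum_congr rfl fun k hk => ?_
  rw [Finset.mem_Icc] at hk
  have h1 := aux_W_exp n hn (k + n) (by rw [abs_le]; omega)
  have h2 := aux_W_exp n hn (k - n) (by rw [abs_le]; omega)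
  have e : ∀ j : ℕ, (auxW n j : ℂ) *
      ((n / Complex.I) * (Complex.exp (Complex.I * ((n : ℤ) : ℂ) * ((2 * π * j / (3 * n : ℕ) : ℝ) : ℂ))
        - Complex.exp (Complex.I * ((-(n : ℤ) : ℤ) : ℂ) * ((2 * π * j / (3 * n : ℕ) : ℝ) : ℂ)))) *
      (c k * Complex.exp (Complex.I * k * ((id (x + 2 * π * j / (3 * n : ℕ)) : ℝ) : ℂ))) =
      (c k * Complex.exp (Complex.I * k * (x : ℂ)) * (n / Complex.I)) *
       ((auxW n j : ℂ) *
      Complex.exp (Complex.I * ((k + n : ℤ) : ℂ) * ((2 * π * j / (3 * n : ℕ) : ℝ) : ℂ)) -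
      (auxW n j : ℂ) *
      Complex.exp (Complex.I * ((k - n : ℤ) : ℂ) * ((2 * π * j / (3 * n : ℕ) : ℝ) : ℂ))) := by
    intro j
    set t : ℝ := 2 * π * j / (3 * n : ℕ)
    have a1 : Complex.exp (Complex.I * ((k + n : ℤ) : ℂ) * (t : ℂ)) =
      Complex.exp (Complex.I * k * t) * Complex.exp (Complex.I * ((n : ℤ) : ℂ) * t) := by
      rw [← Complex.exp_add]; congr 1; push_cast; ring
    have a2 : Complex.exp (Complex.I * ((k - n : ℤ) : ℂ) * (t : ℂ)) =
      Complex.exp (Complex.I * k * t) * Complex.exp (Complex.I * ((-(n : ℤ) : ℤ) : ℂ) * t) := by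
      rw [← Complex.exp_add]; congr 1; push_cast; ring
    have a3 : Complex.exp (Complex.I * k * ((id (x + t) : ℝ) : ℂ)) =
      Complex.exp (Complex.I * k * x) * Complex.exp (Complex.I * k * t) := by
      rw [← Complex.exp_add]; congr 1; simp; ring
    rw [a1, a2, a3]
    ring
  simp_rw [e]
  rw [← Finset.mul_sum, Finset.sum_sub_distrib, h1, h2]
  have h3 : ((max 0 (n - |k + n|) : ℤ) : ℂ) / n - ((max 0 (n - |k - n|) : ℤ) : ℂ) / n = - k / n := by
    rw [← sub_div, ← Int.cast_sub, ← Int.cast_neg]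
    congr 2
    rw [abs_of_nonneg (by omega : 0 ≤ k + n), abs_of_nonpos (by omega : k - n ≤ 0)]
    omega
  rw [h3]
  simp only [id]
  field_simp
  rw [Complex.I_sq]
  ring

lemma aux_D_pow (n : ℕ) (hn : 0 < n) (c : ℤ → ℂ) (x p : ℝ) (hp : 1 ≤ p) :
    ‖auxD n c x‖ ^ p ≤ ∑ j ∈ Finset.range (3 * n), (2 * n : ℝ) ^ p * auxW n j *
      ‖nltrigPoly id n c (x + 2 * π * j / (3 * n : ℕ))‖ ^ p := by
  have h1 : ‖auxD n c x‖ ≤ (2 * n) * ∑ j ∈ Finset.range (3 * n), auxW n j *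
      ‖nltrigPoly id n c (x + 2 * π * j / (3 * n : ℕ))‖ := by
    rw [aux_interp n hn, Finset.mul_sum]
    refine (norm_sum_le _ _).trans (Finset.sum_le_sum fun j _ => ?_)
    set t : ℝ := 2 * π * j / (3 * n : ℕ)
    have hb : ∀ m : ℤ, ‖Complex.exp (Complex.I * (m : ℂ) * (t : ℂ))‖ = 1 := by
      intro m
      rw [Complex.norm_exp]; simp
    have h2 := norm_sub_le (Complex.exp (Complex.I * ((n : ℤ) : ℂ) * (t : ℂ)))
      (Complex.exp (Complex.I * ((-(n : ℤ) : ℤ) : ℂ) * (t : ℂ)))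
    rw [hb, hb] at h2
    rw [norm_mul, norm_mul, norm_mul, Complex.norm_real, Real.norm_of_nonneg (aux_W_nonneg n j),
      norm_div, Complex.norm_I, div_one, Complex.norm_natCast]
    have h3 := mul_le_mul_of_nonneg_left h2 (by have := aux_W_nonneg n j; positivity :
      0 ≤ auxW n j * n * ‖nltrigPoly id n c (x + t)‖)
    linarith
  calc _ ≤ _ := Real.rpow_le_rpow (norm_nonneg _) h1 (by linarith)
    _ = (2 * n : ℝ) ^ p * (∑ j ∈ Finset.range (3 * n), auxW n j *
      ‖nltrigPoly id n c (x + 2 * π * j / (3 * n : ℕ))‖) ^ p := by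
        rw [Real.mul_rpow (by positivity)]
        exact Finset.sum_nonneg fun j _ => mul_nonneg (aux_W_nonneg n j) (norm_nonneg _)
    _ ≤ (2 * n : ℝ) ^ p * ∑ j ∈ Finset.range (3 * n), auxW n j *
      ‖nltrigPoly id n c (x + 2 * π * j / (3 * n : ℕ))‖ ^ p := by
        gcongr
        exact Real.rpow_arith_mean_le_arith_mean_rpow _ _ _ (fun j _ => aux_W_nonneg n j)
          (aux_W_sum n hn) (fun j _ => norm_nonneg _) hp
    _ = _ := by
        rw [Finset.mul_sum]
        exact Finset.sum_congr rfl fun j _ => by ring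

lemma aux_cont (n : ℕ) (c : ℤ → ℂ) (p : ℝ) (hp : 1 ≤ p) :
    Continuous fun x => ‖nltrigPoly id n c x‖ ^ p := by
  refine Continuous.rpow_const ?_ (fun _ => Or.inr (by linarith))
  unfold nltrigPoly
  simp only [id]
  fun_prop

lemma aux_per (n : ℕ) (c : ℤ → ℂ) (p : ℝ) :
    Function.Periodic (fun x => ‖nltrigPoly id n c x‖ ^ p) (2 * π) := by
  intro x
  have : nltrigPoly id n c (x + 2 * π) = nltrigPoly id n c x := by
    unfold nltrigPoly
    refine Finset.sum_congr rfl fun k _ => ?_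
    congr 1
    rw [Complex.exp_eq_exp_iff_exists_int]
    refine ⟨k, ?_⟩
    simp; ring
  simp only [this]

lemma aux_per_int (n : ℕ) (c : ℤ → ℂ) (p : ℝ) (y : ℝ) :
    ∫ x in y..(y + 2 * π), ‖nltrigPoly id n c x‖ ^ p =
      ∫ x in (-π)..π, ‖nltrigPoly id n c x‖ ^ p := by
  have := (aux_per n c p).intervalIntegral_add_eq y (-π)
  rw [this]
  congr 1
  ring

lemma aux_bern (n : ℕ) (c : ℤ → ℂ) (p : ℝ) (hp : 1 ≤ p) :
    ∫ x in (-π)..π, ‖auxD n c x‖ ^ p ≤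
      (2 * n : ℝ) ^ p * ∫ x in (-π)..π, ‖nltrigPoly id n c x‖ ^ p := by
  rcases Nat.eq_zero_or_pos n with rfl | hn
  · have : ∀ x, auxD 0 c x = 0 := by
      intro x; simp [auxD, nltrigPoly]
    simp [this, Real.zero_rpow (by linarith : p ≠ 0)]
  · have hc := aux_cont n c p hp
    have hle : (-π) ≤ π := by linarith [Real.pi_pos]
    calc _ ≤ ∫ x in (-π)..π, ∑ j ∈ Finset.range (3 * n), (2 * n : ℝ) ^ p * auxW n j *
            ‖nltrigPoly id n c (x + 2 * π * j / (3 * n : ℕ))‖ ^ p := by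
          refine intervalIntegral.integral_mono_on hle ?_ ?_ fun x _ => aux_D_pow n hn c x p hp
          · exact (aux_cont n _ p hp).intervalIntegrable _ _
          · refine Continuous.intervalIntegrable ?_ _ _
            refine continuous_finsetSum _ fun j _ => continuous_const.mul ?_
            exact hc.comp (continuous_id.add continuous_const)
      _ = ∑ j ∈ Finset.range (3 * n), (2 * n : ℝ) ^ p * auxW n j *
            ∫ x in (-π)..π, ‖nltrigPoly id n c x‖ ^ p := by
          rw [intervalIntegral.integral_finsetSum]
          · refine Finset.sum_congr rfl fun j _ => ?_
            rw [intervalIntegral.integral_const_mul]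
            congr 1
            rw [intervalIntegral.integral_comp_add_right (fun x => ‖nltrigPoly id n c x‖ ^ p)]
            rw [← aux_per_int n c p (-π + 2 * π * j / (3 * n : ℕ))]
            congr 1
            ring
          · intro j _
            refine Continuous.intervalIntegrable ?_ _ _
            refine continuous_const.mul ?_
            exact hc.comp (continuous_id.add continuous_const)
      _ = _ := by
          rw [← Finset.sum_mul, ← Finset.mul_sum, aux_W_sum n hn, mul_one]

lemma aux_change (θ P : ℝ → ℝ) (hθ : ∀ t : ℝ, θ (t + 2 * π) = θ t + 2 * π)
    (hd : ∀ t, HasDerivAt θ (P t) t) (hP : Continuous P)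
    (n : ℕ) (c : ℤ → ℂ) (p : ℝ) (hp : 1 ≤ p) :
    ∫ x in (-π)..π, ‖nltrigPoly id n c (θ x)‖ ^ p * P x =
      ∫ x in (-π)..π, ‖nltrigPoly id n c x‖ ^ p := by
  have h := intervalIntegral.integral_comp_mul_deriv (a := -π) (b := π) (f := θ) (f' := P)
    (g := fun x => ‖nltrigPoly id n c x‖ ^ p) (fun x _ => hd x) hP.continuousOn
    (aux_cont n c p hp)
  simp only [Function.comp] at h
  rw [h, ← aux_per_int n c p (θ (-π)), ← hθ]
  congr 2
  ring

lemma aux_deriv (θ P : ℝ → ℝ) (hd : ∀ t, HasDerivAt θ (P t) t) (n : ℕ) (c : ℤ → ℂ) (x : ℝ) :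
    deriv (nltrigPoly θ n c) x = auxD n c (θ x) * P x := by
  apply HasDerivAt.deriv
  have : nltrigPoly θ n c = fun x => ∑ k ∈ Finset.Icc (-(n : ℤ)) (n : ℤ),
    c k * Complex.exp (Complex.I * (k : ℂ) * (θ x : ℂ)) := rfl
  rw [this, auxD, nltrigPoly, Finset.sum_mul]
  refine HasDerivAt.fun_sum fun k _ => ?_
  have h := ((((hd x).ofReal_comp).const_mul (Complex.I * (k : ℂ))).cexp).const_mul (c k)
  refine h.congr_deriv ?_
  simp only [id]
  ring

lemma aux_main (θ P : ℝ → ℝ) (M : ℝ) (hM : 1 ≤ M) (hθ : ∀ t : ℝ, θ (t + 2 * π) = θ t + 2 * π)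
    (hd : ∀ t, HasDerivAt θ (P t) t) (hP : Continuous P) (hP0 : ∀ t, 0 ≤ P t) (hPM : ∀ t, P t ≤ M)
    (n : ℕ) (c : ℤ → ℂ) (p : ℝ) (hp : 1 ≤ p) :
    pNorm p (deriv (nltrigPoly θ n c)) ≤ 2 * n * M * pNorm p (nltrigPoly θ n c) := by
  have hle : (-π) ≤ π := by linarith [Real.pi_pos]
  have hp0 : 0 < p := by linarith
  have hθc : Continuous θ := continuous_iff_continuousAt.2 fun t => (hd t).continuousAt
  have hcomp : ∀ x, nltrigPoly θ n c x = nltrigPoly id n c (θ x) := fun x => rfl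
  have hc1 : Continuous fun x => ‖auxD n c (θ x)‖ ^ p := (aux_cont n _ p hp).comp hθc
  have hc2 : Continuous fun x => ‖nltrigPoly id n c (θ x)‖ ^ p := (aux_cont n _ p hp).comp hθc
  have hMp : M ^ p = M ^ (p - 1) * M := by
    rw [← Real.rpow_add_one (by linarith)]; congr 1; ring
  have key : ∫ x in (-π)..π, ‖deriv (nltrigPoly θ n c) x‖ ^ p ≤
      (2 * n * M) ^ p * ∫ x in (-π)..π, ‖nltrigPoly θ n c x‖ ^ p := by
    simp_rw [aux_deriv θ P hd, hcomp]
    calc ∫ x in (-π)..π, ‖auxD n c (θ x) * P x‖ ^ p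
        ≤ ∫ x in (-π)..π, M ^ (p - 1) * (‖auxD n c (θ x)‖ ^ p * P x) := by
          have e : ∀ x, ‖auxD n c (θ x) * P x‖ ^ p = ‖auxD n c (θ x)‖ ^ p * P x ^ p := by
            intro x
            rw [norm_mul, Complex.norm_real, Real.norm_of_nonneg (hP0 x),
              Real.mul_rpow (norm_nonneg _) (hP0 x)]
          simp_rw [e]
          refine intervalIntegral.integral_mono_on hle ?_ ?_ fun x _ => ?_
          · exact (hc1.mul (hP.rpow_const fun _ => Or.inr hp0.le)).intervalIntegrable _ _
          · exact (continuous_const.mul (hc1.mul hP)).intervalIntegrable _ _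
          · have h1 : P x ^ p ≤ M ^ (p - 1) * P x := by
              have : P x ^ p = P x ^ (p - 1) * P x := by
                rcases (hP0 x).eq_or_lt with h | h
                · rw [← h, Real.zero_rpow hp0.ne', mul_zero]
                · rw [← Real.rpow_add_one h.ne']; congr 1; ring
              rw [this]
              exact mul_le_mul_of_nonneg_right
                (Real.rpow_le_rpow (hP0 x) (hPM x) (by linarith)) (hP0 x)
            have := mul_le_mul_of_nonneg_left h1
              (by positivity : 0 ≤ ‖auxD n c (θ x)‖ ^ p)
            linarith
      _ = M ^ (p - 1) * ∫ x in (-π)..π, ‖auxD n c x‖ ^ p := by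
          rw [intervalIntegral.integral_const_mul]
          congr 1
          exact aux_change θ P hθ hd hP n _ p hp
      _ ≤ M ^ (p - 1) * ((2 * n : ℝ) ^ p * ∫ x in (-π)..π, ‖nltrigPoly id n c x‖ ^ p) := by
          gcongr
          exact aux_bern n c p hp
      _ = M ^ (p - 1) * ((2 * n : ℝ) ^ p *
            ∫ x in (-π)..π, ‖nltrigPoly id n c (θ x)‖ ^ p * P x) := by
          rw [aux_change θ P hθ hd hP n c p hp]
      _ ≤ M ^ (p - 1) * ((2 * n : ℝ) ^ p *
            ∫ x in (-π)..π, ‖nltrigPoly id n c (θ x)‖ ^ p * M) := by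
          gcongr
          refine intervalIntegral.integral_mono_on hle ?_ ?_ fun x _ => ?_
          · exact (hc2.mul hP).intervalIntegrable _ _
          · exact (hc2.mul continuous_const).intervalIntegrable _ _
          · exact mul_le_mul_of_nonneg_left (hPM x) (by positivity)
      _ = _ := by
          rw [intervalIntegral.integral_mul_const, Real.mul_rpow (x := 2 * (n : ℝ)) (by positivity) (by linarith),
            hMp]
          ring
  have hI : 0 ≤ ∫ x in (-π)..π, ‖nltrigPoly θ n c x‖ ^ p :=
    intervalIntegral.integral_nonneg hle fun x _ => by positivity
  have hI' : 0 ≤ ∫ x in (-π)..π, ‖deriv (nltrigPoly θ n c) x‖ ^ p :=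
    intervalIntegral.integral_nonneg hle fun x _ => by positivity
  have hpi := Real.pi_pos
  have hK : 0 ≤ 2 * n * M := by positivity
  unfold pNorm
  calc _ ≤ ((2 * n * M) ^ p * (1 / (2 * π) * ∫ x in (-π)..π, ‖nltrigPoly θ n c x‖ ^ p)) ^ (1 / p) := by
        refine Real.rpow_le_rpow (by positivity) ?_ (by positivity)
        have := mul_le_mul_of_nonneg_left key (by positivity : 0 ≤ 1 / (2 * π))
        linarith
    _ = _ := by
        rw [Real.mul_rpow (by positivity) (by positivity), ← Real.rpow_mul hK,
          mul_one_div_cancel hp0.ne', Real.rpow_one]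

theorem bernstein_inequality_nonlinear_trig_polys :
    ∃ C : ℝ, 0 < C ∧
      ∀ (a : ℂ), ‖a‖ < 1 →
      ∀ ta : ℝ, a = (‖a‖ : ℂ) * Complex.exp (Complex.I * (ta : ℂ)) →
      ∀ θ : ℝ → ℝ, (∀ t : ℝ, θ (t + 2 * π) = θ t + 2 * π) →
        (∀ t : ℝ, HasDerivAt θ (poisson a ta t) t) →
      ∀ p : ℝ, 1 ≤ p →
      ∀ (n : ℕ) (c : ℤ → ℂ),
        pNorm p (deriv (nltrigPoly θ n c)) ≤
          C * n * ((1 + ‖a‖) / (1 - ‖a‖)) ^ (2 + 2 / p) *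
            pNorm p (nltrigPoly θ n c) := by
  refine ⟨2, by norm_num, ?_⟩
  intro a ha ta _ θ hθ hd p hp n c
  have hr0 := norm_nonneg a
  have hden : ∀ t, (1 - ‖a‖) ^ 2 ≤ 1 - 2 * ‖a‖ * Real.cos (t - ta) + ‖a‖ ^ 2 := by
    intro t
    nlinarith [Real.cos_le_one (t - ta)]
  have hpos : 0 < 1 - ‖a‖ := by linarith
  have hdpos : ∀ t, 0 < 1 - 2 * ‖a‖ * Real.cos (t - ta) + ‖a‖ ^ 2 := fun t =>
    lt_of_lt_of_le (by positivity) (hden t)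
  have hM : 1 ≤ (1 + ‖a‖) / (1 - ‖a‖) := by
    rw [le_div_iff₀ hpos]; linarith
  have hPc : Continuous (poisson a ta) := by
    unfold poisson
    exact Continuous.div (by fun_prop) (by fun_prop) fun t => (hdpos t).ne'
  have hP0 : ∀ t, 0 ≤ poisson a ta t := fun t =>
    div_nonneg (by nlinarith) (hdpos t).le
  have hPM : ∀ t, poisson a ta t ≤ (1 + ‖a‖) / (1 - ‖a‖) := by
    intro t
    unfold poisson
    rw [div_le_div_iff₀ (hdpos t) hpos]
    have := mul_le_mul_of_nonneg_left (hden t) (by positivity : 0 ≤ 1 + ‖a‖)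
    linarith
  refine (aux_main θ _ _ hM hθ hd hPc hP0 hPM n c p hp).trans ?_
  have hpn : 0 ≤ pNorm p (nltrigPoly θ n c) := by
    unfold pNorm
    refine Real.rpow_nonneg (mul_nonneg (by positivity) ?_) _
    exact intervalIntegral.integral_nonneg (by linarith [Real.pi_pos]) fun x _ => by positivity
  refine mul_le_mul_of_nonneg_right (mul_le_mul_of_nonneg_left ?_ (by positivity)) hpn
  have : (0 : ℝ) < 2 / p := by positivity
  exact Real.self_le_rpow_of_one_le hM (by linarith)
end
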